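/- C(t_m)=0 for 0≤m≤6, and C(t_m)=(t_{m-5}+t_{m-6}−m+3)/2 for every m≥7. -/

import Mathlib

/-- The three-letter alphabet of the Tribonacci word. -/
inductive TLetter : Type
  | a | b | c
deriving DecidableEq

/-- The Tribonacci substitution σ(a)=ab, σ(b)=ac, σ(c)=a. -/
def tsubst : TLetter → List TLetter
  | .a => [.a, .b]
  | .b => [.a, .c]
  | .c => [.a]

/-- `Tword m = σ^m(a)`, the m-th finite Tribonacci word. -/
def Tword : ℕ → List TLetter
  | 0 => [.a]
  | n + 1 => (Tword n).flatMap tsubst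

/-- The prefix 𝕋[1,n] of the Tribonacci word of length n
(each `Tword n` is a prefix of the next and has length ≥ n). -/
def TPrefix (n : ℕ) : List TLetter := (Tword n).take n

/-- A word is a factor of the Tribonacci word 𝕋. -/
def IsFactorT (w : List TLetter) : Prop := ∃ m, w <:+: Tword m

/-- `tribAux i = t_{i-2}`: Tribonacci numbers, shifted so that the index is a natural. -/
def tribAux : ℕ → ℕ
  | 0 => 0
  | 1 => 1
  | 2 => 1
  | n + 3 => tribAux (n + 2) + tribAux (n + 1) + tribAux n

/-- The Tribonacci numbers `t m` for `m : ℤ`: t₋₂=0, t₋₁=1, t₀=1,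
`t m = t (m-1) + t (m-2) + t (m-3)` for m ≥ 1. (Junk value 0 below -2.) -/
def t (m : ℤ) : ℕ := tribAux (m + 2).toNat

/-- Kernel numbers: k₀=0, k₁=k₂=1, `k m = k (m-1) + k (m-2) + k (m-3) - 1` for m ≥ 3. -/
def kAux : ℕ → ℕ
  | 0 => 0
  | 1 => 1
  | 2 => 1
  | n + 3 => kAux (n + 2) + kAux (n + 1) + kAux n - 1

def kker (m : ℤ) : ℕ := kAux m.toNat

/-- `A n`: the number of distinct nonempty words w with ww a factor of 𝕋[1,n]. -/
noncomputable def A (n : ℕ) : ℕ := Nat.card {w : List TLetter // w ≠ [] ∧ (w ++ w) <:+: TPrefix n}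

/-- `B n`: the number of occurrences of squares in 𝕋[1,n], i.e. of pairs (w,i) with
w nonempty, i ≥ 1, ww occurring in 𝕋 at position i and i + 2|w| - 1 ≤ n. -/
noncomputable def B (n : ℕ) : ℕ :=
  Nat.card {p : List TLetter × ℕ // p.1 ≠ [] ∧ 1 ≤ p.2 ∧
    p.2 + 2 * p.1.length - 1 ≤ n ∧ (p.1 ++ p.1) <+: (TPrefix n).drop (p.2 - 1)}

/-- `C n`: the number of distinct nonempty words w with www a factor of 𝕋[1,n]. -/
noncomputable def C (n : ℕ) : ℕ := Nat.card {w : List TLetter // w ≠ [] ∧ (w ++ w ++ w) <:+: TPrefix n}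

/-- `D n`: the number of occurrences of cubes in 𝕋[1,n], i.e. of pairs (w,i) with
w nonempty, i ≥ 1, www occurring in 𝕋 at position i and i + 3|w| - 1 ≤ n. -/
noncomputable def D (n : ℕ) : ℕ :=
  Nat.card {p : List TLetter × ℕ // p.1 ≠ [] ∧ 1 ≤ p.2 ∧
    p.2 + 3 * p.1.length - 1 ≤ n ∧ (p.1 ++ p.1 ++ p.1) <+: (TPrefix n).drop (p.2 - 1)}

namespace Tribonacci

theorem flatMap_tsubst_isPrefix {u v : List TLetter} (h : u <+: v) :
    u.flatMap tsubst <+: v.flatMap tsubst := by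
  obtain ⟨r, rfl⟩ := h
  rw [List.flatMap_append]
  exact List.prefix_append _ _

theorem Tword_isPrefix_succ (n : ℕ) : Tword n <+: Tword (n + 1) := by
  induction n with
  | zero => exact ⟨[.b], rfl⟩
  | succ n ih => exact flatMap_tsubst_isPrefix ih

theorem Tword_isPrefix {m n : ℕ} (h : m ≤ n) : Tword m <+: Tword n := by
  induction n, h using Nat.le_induction with
  | base => exact List.prefix_rfl
  | succ n _ ih => exact ih.trans (Tword_isPrefix_succ n)

theorem length_le_length_flatMap_tsubst (u : List TLetter) :
    u.length ≤ (u.flatMap tsubst).length := by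
  induction u with
  | nil => simp
  | cons x u ih =>
    have hx : 1 ≤ (tsubst x).length := by cases x <;> simp [tsubst]
    rw [List.flatMap_cons, List.length_append, List.length_cons]
    omega

theorem lt_length_Tword (n : ℕ) : n < (Tword n).length := by
  suffices h : n < (Tword n).length ∧ TLetter.a ∈ Tword n from h.1
  induction n with
  | zero => simp [Tword]
  | succ n ih =>
    obtain ⟨ih, hmem⟩ := ih
    obtain ⟨u, v, huv⟩ := List.append_of_mem hmem
    have hu := length_le_length_flatMap_tsubst u
    have hv := length_le_length_flatMap_tsubst v
    rw [huv] at ih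
    simp only [Tword, huv, List.flatMap_append, List.flatMap_cons, tsubst]
    simp only [List.length_append, List.length_cons, List.length_nil] at *
    exact ⟨by omega, by simp⟩

/-- The letters of the Tribonacci word, indexed from `0`. -/
def letter (i : ℕ) : TLetter := (Tword i)[i]?.getD .a

/-- The factor of length `p` of the Tribonacci word that starts at position `i`. -/
def factor (i p : ℕ) : List TLetter := (List.range p).map fun k => letter (i + k)

@[simp] theorem length_factor (i p : ℕ) : (factor i p).length = p := by simp [factor]

theorem factor_add (i p r : ℕ) : factor i (p + r) = factor i p ++ factor (i + p) r := by
  simp [factor, List.range_add, Function.comp_def, Nat.add_assoc]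

theorem factor_eq_factor_iff {i j p : ℕ} :
    factor i p = factor j p ↔ ∀ k < p, letter (i + k) = letter (j + k) := by
  simp [factor]

theorem Tword_getElem? {n i : ℕ} (h : i < (Tword n).length) :
    (Tword n)[i]? = some (letter i) := by
  have hi := lt_length_Tword i
  have key : (Tword n)[i]? = (Tword i)[i]? := by
    rcases le_total i n with hin | hin
    · rw [List.prefix_iff_getElem?.mp (Tword_isPrefix hin) i hi, List.getElem?_eq_getElem hi]
    · rw [List.prefix_iff_getElem?.mp (Tword_isPrefix hin) i h, List.getElem?_eq_getElem h]
  rw [key, letter, List.getElem?_eq_getElem hi]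
  rfl

theorem eq_factor_of_isPrefix_Tword {u : List TLetter} {n : ℕ} (h : u <+: Tword n) :
    u = factor 0 u.length := by
  apply List.ext_getElem?
  intro i
  by_cases hi : i < u.length
  · have := h.length_le
    rw [List.getElem?_eq_getElem hi, ← List.prefix_iff_getElem?.mp h i hi,
      Tword_getElem? (by omega)]
    simp [factor, hi]
  · rw [List.getElem?_eq_none (by omega), List.getElem?_eq_none (by simp; omega)]

/-- The position at which the image of the `k`-th letter starts when the Tribonacci word is
read as its own image under the substitution. -/
def blockStart : ℕ → ℕ
  | 0 => 0
  | k + 1 => blockStart k + (tsubst (letter k)).length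

theorem factor_isPrefix_Tword (k : ℕ) : factor 0 k <+: Tword k := by
  have h := List.take_prefix k (Tword k)
  have h' := eq_factor_of_isPrefix_Tword h
  rw [List.length_take, min_eq_left (lt_length_Tword k).le] at h'
  rwa [← h']

theorem flatMap_factor (k : ℕ) : (factor 0 k).flatMap tsubst = factor 0 (blockStart k) := by
  have hlen : ((factor 0 k).flatMap tsubst).length = blockStart k := by
    induction k with
    | zero => rfl
    | succ k ih =>
      rw [factor_add, List.flatMap_append, List.length_append, ih]
      simp [factor, blockStart]
  rw [← hlen]
  exact eq_factor_of_isPrefix_Tword (n := k + 1) (flatMap_tsubst_isPrefix (factor_isPrefix_Tword k))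

theorem tsubst_letter (k : ℕ) :
    tsubst (letter k) = factor (blockStart k) (tsubst (letter k)).length := by
  have h := flatMap_factor (k + 1)
  rw [factor_add, List.flatMap_append, flatMap_factor, blockStart, factor_add,
    List.append_cancel_left_eq] at h
  simpa [factor] using h

theorem letter_blockStart (k : ℕ) : letter (blockStart k) = .a := by
  have h := tsubst_letter k
  cases hk : letter k <;> simp_all [tsubst, factor, List.range_succ]

theorem block_cases (k : ℕ) :
    (letter k = .a ∧ blockStart (k + 1) = blockStart k + 2 ∧ letter (blockStart k + 1) = .b) ∨
    (letter k = .b ∧ blockStart (k + 1) = blockStart k + 2 ∧ letter (blockStart k + 1) = .c) ∨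
    (letter k = .c ∧ blockStart (k + 1) = blockStart k + 1 ∧ letter (blockStart k + 1) = .a) := by
  have h := tsubst_letter k
  have h1 : blockStart (k + 1) = blockStart k + (tsubst (letter k)).length := rfl
  have h2 := letter_blockStart (k + 1)
  rw [h1] at h2
  rw [h1]
  generalize letter k = x at *
  cases x <;>
    simp only [tsubst, List.length_cons, List.length_nil, factor, List.range_succ,
      List.range_zero, List.nil_append, List.cons_append, List.map_cons, List.map_nil,
      List.cons.injEq, zero_add, Nat.reduceAdd] at * <;> simp_all

theorem blockStart_strictMono : StrictMono blockStart :=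
  strictMono_nat_of_lt_succ fun k => by
    rcases block_cases k with h | h | h <;> omega

theorem add_le_blockStart_add (m k : ℕ) : blockStart m + k ≤ blockStart (m + k) := by
  induction k with
  | zero => rfl
  | succ k ih =>
    have : blockStart (m + k) < blockStart (m + (k + 1)) := blockStart_strictMono (by omega)
    omega

theorem exists_blockStart (i : ℕ) :
    ∃ k, i = blockStart k ∨ (i = blockStart k + 1 ∧ letter i ≠ .a) := by
  induction i with
  | zero => exact ⟨0, .inl rfl⟩
  | succ i ih =>
    obtain ⟨k, rfl | ⟨rfl, hi⟩⟩ := ih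
    · rcases block_cases k with h | h | h
      · exact ⟨k, .inr ⟨rfl, by simp [h.2.2]⟩⟩
      · exact ⟨k, .inr ⟨rfl, by simp [h.2.2]⟩⟩
      · exact ⟨k + 1, .inl h.2.1.symm⟩
    · rcases block_cases k with h | h | h
      · exact ⟨k + 1, .inl h.2.1.symm⟩
      · exact ⟨k + 1, .inl h.2.1.symm⟩
      · exact absurd h.2.2 hi

theorem exists_eq_blockStart {i : ℕ} (h : letter i = .a) : ∃ k, i = blockStart k := by
  obtain ⟨k, hk | hk⟩ := exists_blockStart i
  · exact ⟨k, hk⟩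
  · exact absurd h hk.2

theorem exists_eq_blockStart_add_one {i : ℕ} (h : letter i ≠ .a) : ∃ k, i = blockStart k + 1 := by
  obtain ⟨k, rfl | hk⟩ := exists_blockStart i
  · exact absurd (letter_blockStart k) h
  · exact ⟨k, hk.1⟩

theorem blockStart_add_two (k : ℕ) : blockStart k + 3 ≤ blockStart (k + 2) := by
  have h1 := block_cases k
  have h2 := block_cases (k + 1)
  have h3 : ¬ (letter k = .c ∧ letter (k + 1) = .c) := by
    rintro ⟨h, h'⟩
    obtain ⟨m, hm⟩ := exists_eq_blockStart_add_one (i := k + 1) (by simp [h'])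
    obtain rfl : k = blockStart m := by omega
    simp [letter_blockStart] at h
  rw [show k + 1 + 1 = k + 2 from rfl] at h2
  grind

theorem letter_eq_of_letter_blockStart_add_one {k l : ℕ}
    (h : letter (blockStart k + 1) = letter (blockStart l + 1)) : letter k = letter l := by
  have h1 := block_cases k
  have h2 := block_cases l
  grind

theorem blockStart_add_of_agree {u v N : ℕ}
    (h : ∀ k < N, letter (u + k) = letter (v + k)) {k : ℕ} (hk : k ≤ N) :
    blockStart (u + k) + blockStart v = blockStart (v + k) + blockStart u := by
  induction k with
  | zero => simp [add_comm]
  | succ k ih =>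
    have := ih (by omega)
    have hs := congrArg (fun x => (tsubst x).length) (h k (by omega))
    have hu : blockStart (u + (k + 1)) = blockStart (u + k) + (tsubst (letter (u + k))).length := rfl
    have hv : blockStart (v + (k + 1)) = blockStart (v + k) + (tsubst (letter (v + k))).length := rfl
    omega

theorem agree_blockStart {v N : ℕ} (h : ∀ k < N, letter k = letter (v + k)) :
    ∀ k < blockStart N + 1, letter k = letter (blockStart v + k) := by
  intro k hk
  have shift : ∀ m ≤ N, blockStart (v + m) = blockStart v + blockStart m := by
    intro m hm
    have := blockStart_add_of_agree (u := 0) (v := v) (N := N) (by simpa using h) hm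
    simp only [zero_add, blockStart] at this
    omega
  obtain ⟨m, rfl | ⟨rfl, hm⟩⟩ := exists_blockStart k
  · have hmN : m ≤ N := blockStart_strictMono.le_iff_le.mp (by omega)
    rw [← shift m hmN, letter_blockStart, letter_blockStart]
  · have hmN : m < N := blockStart_strictMono.lt_iff_lt.mp (by omega)
    have h1 := block_cases m
    have h2 := block_cases (v + m)
    rw [shift m hmN.le, add_assoc] at h2
    have := h m hmN
    grind

/-- The length of the `j`-th finite Tribonacci word. -/
def wordLen (j : ℕ) : ℕ := blockStart^[j] 1

/-- The number of matching positions in a maximal repetition of period `wordLen j`. -/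
def matchLen : ℕ → ℕ
  | 0 => 1
  | j + 1 => blockStart (matchLen j) + 1

theorem agree_iterate {v N : ℕ} (h : ∀ k < N, letter k = letter (v + k)) (j : ℕ) :
    (∀ k < blockStart^[j] N, letter k = letter (blockStart^[j] v + k)) ∧
      blockStart^[j] (v + N) = blockStart^[j] v + blockStart^[j] N := by
  induction j generalizing v N with
  | zero => exact ⟨h, rfl⟩
  | succ j ih =>
    have h1 := agree_blockStart h
    have h2 := blockStart_add_of_agree (u := 0) (v := v) (N := N) (by simpa using h) le_rfl
    simp only [zero_add, blockStart] at h2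
    simp only [Function.iterate_succ, Function.comp]
    rw [show blockStart (v + N) = blockStart v + blockStart N by omega]
    exact ih fun k hk => h1 k (by omega)

theorem letter_values : letter 0 = .a ∧ letter 1 = .b ∧ letter 2 = .a ∧ letter 3 = .c ∧
    letter 4 = .a ∧ letter 5 = .b ∧ letter 6 = .a ∧ letter 7 = .a := by
  decide

theorem agree_matchLen {v : ℕ} (h : letter v = .a) (j : ℕ) :
    ∀ k < matchLen j, letter k = letter (blockStart^[j] v + k) := by
  induction j with
  | zero =>
    intro k hk
    obtain rfl : k = 0 := by simp [matchLen] at hk; omega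
    simpa [h] using letter_values.1
  | succ j ih =>
    rw [Function.iterate_succ_apply']
    exact agree_blockStart ih

theorem wordLen_succ (j : ℕ) : wordLen (j + 1) = blockStart (wordLen j) :=
  Function.iterate_succ_apply' ..

theorem wordLen_zero : wordLen 0 = 1 := rfl

theorem wordLen_one : wordLen 1 = 2 := by decide

theorem wordLen_two : wordLen 2 = 4 := by decide

theorem iterate_succ_of_letter_eq {q : ℕ} (h : letter q = .a) (j : ℕ) :
    blockStart^[j] (q + 1) = blockStart^[j] q + wordLen j :=
  (agree_iterate (v := q) (N := 1) (by simp [h, letter_values.1]) j).2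

theorem iterate_six (j : ℕ) : blockStart^[j] 6 = wordLen (j + 2) + wordLen (j + 1) := by
  obtain ⟨h0, h1, -, -, h4, h5, -⟩ := letter_values
  have h := (agree_iterate (v := 4) (N := 2) (by
    intro k hk
    interval_cases k <;> simp [*]) j).2
  rw [show (6 : ℕ) = 4 + 2 from rfl, h, wordLen, wordLen, Function.iterate_add_apply,
    Function.iterate_add_apply]
  congr 2

theorem wordLen_add_three (j : ℕ) :
    wordLen (j + 3) = wordLen (j + 2) + wordLen (j + 1) + wordLen j := by
  have h := iterate_succ_of_letter_eq (q := 6) (by simp [letter_values]) j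
  rw [iterate_six] at h
  rw [← h, wordLen, Function.iterate_add_apply]
  congr 1

theorem wordLen_strictMono : StrictMono wordLen := by
  refine strictMono_nat_of_lt_succ fun j => ?_
  suffices h : wordLen j < wordLen (j + 1) ∧ wordLen (j + 1) < wordLen (j + 2) from h.1
  induction j with
  | zero => simp [wordLen_zero, wordLen_one, wordLen_two]
  | succ j ih =>
    have := wordLen_add_three j
    exact ⟨ih.2, by simp only [add_assoc, Nat.reduceAdd]; omega⟩

theorem matchLen_succ (j : ℕ) : matchLen (j + 1) = wordLen (j + 1) + matchLen j := by
  have h2 : letter 2 = .a := by simp [letter_values]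
  induction j with
  | zero => decide
  | succ j ih =>
    have h := agree_matchLen h2 j
    have hw : blockStart^[j] 2 = wordLen (j + 1) := by
      rw [wordLen, Function.iterate_add_apply]
      congr 1
    have h' := blockStart_add_of_agree (u := 0) (v := blockStart^[j] 2) (by simpa using h) le_rfl
    simp only [zero_add, blockStart] at h'
    rw [hw, ← wordLen_succ, ← ih] at h'
    simp only [matchLen] at h' ⊢
    omega

theorem two_mul_matchLen (j : ℕ) : 2 * matchLen j + 3 = wordLen (j + 2) + wordLen j := by
  induction j with
  | zero => decide
  | succ j ih =>
    have h1 := matchLen_succ j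
    have h2 := wordLen_add_three j
    simp only [add_assoc, Nat.reduceAdd] at *
    omega

theorem matchLen_lt (j : ℕ) : matchLen j < 3 * wordLen j := by
  have h : wordLen (j + 2) ≤ 2 * wordLen (j + 1) ∧ wordLen (j + 1) ≤ 2 * wordLen j ∧
      wordLen (j + 3) ≤ 2 * wordLen (j + 2) := by
    induction j with
    | zero => simp [wordLen_add_three, wordLen_zero, wordLen_one, wordLen_two]
    | succ j ih =>
      have := wordLen_add_three j
      have := wordLen_add_three (j + 1)
      simp only [add_assoc, Nat.reduceAdd] at *
      omega
  have := two_mul_matchLen j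
  omega

theorem matchLen_le (j : ℕ) : matchLen j ≤ wordLen (j + 2) + wordLen (j + 1) := by
  have := two_mul_matchLen j
  have := wordLen_strictMono (show j < j + 1 by omega)
  omega

/-- Desubstitution of a repetition starting with the letter `a`. -/
theorem desubstitute_of_blockStart {p m L : ℕ} (hp : 1 ≤ p) (hL : 2 * p ≤ L + 1)
    (h : ∀ k < L, letter (blockStart m + k) = letter (blockStart m + k + p)) :
    (p = 1 ∧ L = 1) ∨
    ∃ p' L', 1 ≤ p' ∧ p' < p ∧ 2 * p' ≤ L' + 1 ∧
      (∀ k < L', letter (m + k) = letter (m + k + p')) ∧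
      blockStart m + L ≤ blockStart (m + L') + 1 ∧
      blockStart (m + p') = blockStart m + p := by
  have mono := blockStart_strictMono
  obtain ⟨n, hn⟩ := exists_eq_blockStart (i := blockStart m + p) (by
    have := h 0 (by omega)
    simp only [add_zero] at this
    rw [← this, letter_blockStart])
  have hmn : m < n := mono.lt_iff_lt.mp (by omega)
  obtain ⟨p', rfl⟩ := Nat.exists_eq_add_of_lt hmn
  have sync : ∀ k, (k = 0 ∨ blockStart (m + (k - 1)) + 1 < blockStart m + L) →
      blockStart (m + (p' + 1) + k) = blockStart (m + k) + p ∧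
      ∀ l < k, letter (m + l) = letter (m + l + (p' + 1)) := by
    intro k
    induction k with
    | zero => exact fun _ => ⟨hn.symm, by simp⟩
    | succ k ih =>
      intro hk
      have hk : blockStart (m + k) + 1 < blockStart m + L := by simpa using hk
      obtain ⟨h1, h2⟩ := ih (by
        rcases Nat.eq_zero_or_pos k with h0 | h0
        · exact .inl h0
        · right
          have : blockStart (m + (k - 1)) < blockStart (m + k) := mono (by omega)
          omega)
      have hmk : blockStart m ≤ blockStart (m + k) := mono.monotone (by omega)
      have h3 := h (blockStart (m + k) - blockStart m + 1) (by omega)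
      rw [show blockStart m + (blockStart (m + k) - blockStart m + 1) = blockStart (m + k) + 1
        by omega, show blockStart (m + k) + 1 + p = blockStart (m + (p' + 1) + k) + 1 by omega] at h3
      have h4 := letter_eq_of_letter_blockStart_add_one h3
      refine ⟨?_, fun l hl => ?_⟩
      · change blockStart (m + (p' + 1) + k) + (tsubst (letter (m + (p' + 1) + k))).length =
          blockStart (m + k) + (tsubst (letter (m + k))).length + p
        rw [h4, h1]
        omega
      · rcases Nat.lt_succ_iff_lt_or_eq.mp hl with hl | rfl
        · exact h2 l hl
        · rw [h4]
          congr 1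
          omega
  have hex : ∃ k, blockStart m + L ≤ blockStart (m + k) + 1 :=
    ⟨m + L + blockStart m, by have := mono.le_apply (x := m + (m + L + blockStart m)); omega⟩
  obtain ⟨L', hL', hmin⟩ : ∃ k, blockStart m + L ≤ blockStart (m + k) + 1 ∧
      ∀ l < k, blockStart (m + l) + 1 < blockStart m + L :=
    ⟨Nat.find hex, Nat.find_spec hex, fun l hl => by have := Nat.find_min hex hl; omega⟩
  have sync' : ∀ k ≤ L', blockStart (m + (p' + 1) + k) = blockStart (m + k) + p := by
    intro k hk
    refine (sync k ?_).1
    rcases Nat.eq_zero_or_pos k with h0 | h0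
    · exact .inl h0
    · exact .inr (hmin _ (by omega))
  have hmatch : ∀ l < L', letter (m + l) = letter (m + l + (p' + 1)) := by
    intro l hl
    exact (sync (l + 1) (.inr (by simpa using hmin l hl))).2 l (by omega)
  have hn' : blockStart (m + (p' + 1)) = blockStart m + p := hn.symm
  have hbig : 1 ≤ p' → blockStart (m + (p' - 1)) + 3 ≤ blockStart m + p := by
    intro h0
    have := blockStart_add_two (m + (p' - 1))
    rw [show m + (p' - 1) + 2 = m + (p' + 1) by omega] at this
    omega
  by_cases hlen : 2 * (p' + 1) ≤ L' + 1
  · right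
    refine ⟨p' + 1, L', by omega, ?_, hlen, hmatch, hL', hn'⟩
    rcases Nat.eq_zero_or_pos p' with rfl | h0
    · by_contra hlt
      have := hmatch 0 (by omega)
      have h1 := block_cases m
      have h2 := block_cases (m + 1)
      have h3 := blockStart_add_two m
      simp only [add_zero, zero_add] at *
      rw [show m + 1 + 1 = m + 2 from rfl] at h2
      grind
    · have h1 := hbig h0
      have h2 := add_le_blockStart_add m (p' - 1)
      omega
  · rcases Nat.eq_zero_or_pos p' with rfl | h0
    · obtain rfl : L' = 0 := by omega
      simp only [add_zero] at hL'
      left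
      omega
    · exfalso
      have h1 := hbig h0
      rcases le_or_gt (p' + 1) L' with hle | hlt
      · have h2 := sync' (L' - (p' + 1)) (by omega)
        rw [show m + (p' + 1) + (L' - (p' + 1)) = m + L' by omega] at h2
        have h3 : blockStart (m + (L' - (p' + 1))) ≤ blockStart (m + (p' - 1)) :=
          mono.monotone (by omega)
        omega
      · have h3 : blockStart (m + L') < blockStart (m + (p' + 1)) := mono (by omega)
        have h4 := add_le_blockStart_add m (p' + 1)
        omega

/-- A repetition of period `p` and exponent at least `3 - 1/p` sits inside an iterated image of a
factor `aa`. -/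
theorem repetition_structure {p i L : ℕ} (hp : 1 ≤ p) (hL : 2 * p ≤ L + 1)
    (h : ∀ k < L, letter (i + k) = letter (i + k + p)) :
    ∃ j q, letter q = .a ∧ letter (q + 1) = .a ∧ p = wordLen j ∧ blockStart^[j] q ≤ i ∧
      i + L ≤ blockStart^[j] q + matchLen j := by
  induction p using Nat.strong_induction_on generalizing i L with
  | _ p ih =>
  obtain ⟨m, L₀, hmi, hmL, hm1, hm⟩ : ∃ m L₀, blockStart m ≤ i ∧ blockStart m + L₀ = i + L ∧
      L ≤ L₀ ∧ ∀ k < L₀, letter (blockStart m + k) = letter (blockStart m + k + p) := by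
    by_cases ha : letter i = .a
    · obtain ⟨m, rfl⟩ := exists_eq_blockStart ha
      exact ⟨m, L, le_rfl, rfl, le_rfl, h⟩
    · obtain ⟨m, rfl⟩ := exists_eq_blockStart_add_one ha
      have h0 := h 0 (by omega)
      rw [add_zero] at h0
      obtain ⟨n, hn⟩ := exists_eq_blockStart_add_one (by rwa [h0] at ha)
      refine ⟨m, L + 1, by omega, by omega, by omega, fun k hk => ?_⟩
      rcases k with _ | k
      · rw [add_zero, letter_blockStart, show blockStart m + p = blockStart n by omega,
          letter_blockStart]
      · have := h k (by omega)
        rwa [show blockStart m + 1 + k = blockStart m + (k + 1) by omega] at this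
  rcases desubstitute_of_blockStart hp (by omega) hm with
    ⟨rfl, rfl⟩ | ⟨p', L', hp', hlt, hL', hmatch, hend, hper⟩
  · have h0 := hm 0 (by omega)
    rw [add_zero, letter_blockStart] at h0
    exact ⟨0, blockStart m, letter_blockStart m, h0.symm, rfl, hmi, by simp [matchLen]; omega⟩
  · obtain ⟨j, q, hq, hq', rfl, h1, h2⟩ := ih p' hlt hp' hL' hmatch
    have hmono := blockStart_strictMono.monotone
    have hagree := agree_matchLen hq j
    have hagree' := agree_matchLen hq' j
    rw [iterate_succ_of_letter_eq hq] at hagree'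
    refine ⟨j + 1, q, hq, hq', ?_, ?_, ?_⟩
    · have hs := iterate_succ_of_letter_eq hq (j + 1)
      rw [Function.iterate_succ_apply', Function.iterate_succ_apply',
        iterate_succ_of_letter_eq hq] at hs
      have hc := blockStart_add_of_agree (u := blockStart^[j] q)
        (v := blockStart^[j] q + wordLen j) (N := matchLen j)
        (fun k hk => by rw [← hagree k hk, ← hagree' k hk])
        (k := m - blockStart^[j] q) (by omega)
      rw [show blockStart^[j] q + (m - blockStart^[j] q) = m by omega,
        show blockStart^[j] q + wordLen j + (m - blockStart^[j] q) = m + wordLen j by omega] at hc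
      omega
    · rw [Function.iterate_succ_apply']
      exact (hmono h1).trans hmi
    · have hs := blockStart_add_of_agree (u := 0) (v := blockStart^[j] q) (N := matchLen j)
        (by simpa using hagree) le_rfl
      simp only [zero_add, blockStart] at hs
      have := hmono h2
      rw [Function.iterate_succ_apply', matchLen]
      omega

theorem six_le_of_letter_eq {q : ℕ} (h : letter q = .a) (h' : letter (q + 1) = .a) : 6 ≤ q := by
  by_contra! hq
  obtain ⟨_, h1, _, h3, _, h5, _⟩ := letter_values
  interval_cases q <;> simp_all

theorem Tword_eq_factor (n : ℕ) : Tword n = factor 0 (wordLen n) := by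
  induction n with
  | zero => rfl
  | succ n ih => rw [Tword, ih, flatMap_factor, wordLen_succ]

theorem tribAux_add_two (n : ℕ) : tribAux (n + 2) = wordLen n := by
  suffices h : tribAux (n + 2) = wordLen n ∧ tribAux (n + 3) = wordLen (n + 1) ∧
      tribAux (n + 4) = wordLen (n + 2) from h.1
  induction n with
  | zero => decide
  | succ n ih =>
    refine ⟨ih.2.1, ih.2.2, ?_⟩
    rw [show n + 1 + 4 = n + 2 + 3 by omega, tribAux, show n + 1 + 2 = n + 3 by omega,
      wordLen_add_three, ih.1, ih.2.2, ← ih.2.1]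

theorem TPrefix_eq_factor (n : ℕ) : TPrefix n = factor 0 n := by
  have h := eq_factor_of_isPrefix_Tword (List.take_prefix n (Tword n))
  rwa [List.length_take, min_eq_left (lt_length_Tword n).le] at h

theorem isInfix_factor_iff {w : List TLetter} {n : ℕ} :
    w <:+: factor 0 n ↔ ∃ i, i + w.length ≤ n ∧ w = factor i w.length := by
  constructor
  · rintro ⟨s, r, h⟩
    have hn : s.length + w.length + r.length = n := by
      simpa [add_assoc] using congrArg List.length h
    refine ⟨s.length, by omega, ?_⟩
    rw [← hn, factor_add, factor_add, zero_add] at h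
    exact (List.append_inj (List.append_inj h (by simp)).1 (by simp)).2
  · rintro ⟨i, hi, h⟩
    obtain ⟨r, rfl⟩ := Nat.exists_eq_add_of_le hi
    rw [factor_add, factor_add, zero_add, ← h]
    exact ⟨_, _, rfl⟩

theorem cube_isInfix_factor_iff {w : List TLetter} {n : ℕ} :
    w ++ w ++ w <:+: factor 0 n ↔ ∃ i, i + 3 * w.length ≤ n ∧ w = factor i w.length ∧
      ∀ k < 2 * w.length, letter (i + k) = letter (i + k + w.length) := by
  rw [isInfix_factor_iff]
  refine exists_congr fun i => ?_
  have hlen : (w ++ w ++ w).length = w.length + w.length + w.length := by simp [add_assoc]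
  rw [hlen, show 3 * w.length = w.length + w.length + w.length by omega]
  refine and_congr_right fun _ => ?_
  rw [factor_add, factor_add]
  constructor
  · intro h
    obtain ⟨h12, h3⟩ := List.append_inj h (by simp)
    obtain ⟨h1, h2⟩ := List.append_inj h12 (by simp)
    refine ⟨h1, fun k hk => ?_⟩
    have e1 := factor_eq_factor_iff.mp (h1.symm.trans h2)
    have e2 := factor_eq_factor_iff.mp (h2.symm.trans h3)
    rcases lt_or_ge k w.length with hlt | hge
    · rw [e1 k hlt]
      congr 1
      omega
    · have := e2 (k - w.length) (by omega)
      rwa [show i + w.length + (k - w.length) = i + k by omega,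
        show i + (w.length + w.length) + (k - w.length) = i + k + w.length by omega] at this
  · rintro ⟨h1, h⟩
    have e1 : factor i w.length = factor (i + w.length) w.length :=
      factor_eq_factor_iff.mpr fun k hk => by
        rw [h k (by omega)]
        congr 1
        omega
    have e2 : factor (i + w.length) w.length = factor (i + (w.length + w.length)) w.length :=
      factor_eq_factor_iff.mpr fun k hk => by
        rw [add_assoc, h _ (by omega)]
        congr 1
        omega
    rw [← e2, ← e1, ← h1]

theorem agree_iterate_six (j : ℕ) :
    (∀ k < matchLen j, letter (blockStart^[j] 6 + k) = letter k) ∧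
      ∀ k < matchLen j, letter (blockStart^[j] 6 + k) = letter (blockStart^[j] 6 + k + wordLen j) := by
  have h6 : letter 6 = .a := by simp [letter_values]
  have h7 : letter (6 + 1) = .a := by simp [letter_values]
  have h := agree_matchLen h6 j
  have h' := agree_matchLen h7 j
  rw [iterate_succ_of_letter_eq h6] at h'
  refine ⟨fun k hk => (h k hk).symm, fun k hk => ?_⟩
  rw [← h k hk, h' k hk]
  congr 1
  omega

/-- The cubes in the `n`-th finite Tribonacci word. -/
theorem cube_isInfix_iff {w : List TLetter} {n : ℕ} :
    (w ≠ [] ∧ w ++ w ++ w <:+: factor 0 (wordLen n)) ↔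
      ∃ j k, j + 4 ≤ n ∧ k + 2 * wordLen j ≤ matchLen j ∧ factor k (wordLen j) = w := by
  rw [cube_isInfix_factor_iff]
  constructor
  · rintro ⟨hw, i, hi, hwi, hmatch⟩
    have hpos := List.length_pos_iff.mpr hw
    obtain ⟨j, q, hq, hq', hp, h1, h2⟩ := repetition_structure hpos (by omega) hmatch
    have hu : wordLen (j + 2) + wordLen (j + 1) ≤ blockStart^[j] q := by
      rw [← iterate_six]
      exact blockStart_strictMono.monotone.iterate j (six_le_of_letter_eq hq hq')
    refine ⟨j, i - blockStart^[j] q, ?_, by omega, ?_⟩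
    · by_contra! hn
      have := wordLen_strictMono.monotone (show n ≤ j + 3 by omega)
      have := wordLen_add_three j
      omega
    · rw [hwi, ← hp, factor_eq_factor_iff]
      intro k hk
      rw [agree_matchLen hq j _ (by omega)]
      congr 1
      omega
  · rintro ⟨j, k, hj, hk, rfl⟩
    have hpos : 1 ≤ wordLen j := wordLen_strictMono.monotone (Nat.zero_le j)
    obtain ⟨h1, h2⟩ := agree_iterate_six j
    refine ⟨by rw [← List.length_pos_iff, length_factor]; exact hpos, blockStart^[j] 6 + k, ?_⟩
    rw [length_factor]
    refine ⟨?_, ?_, fun l hl => ?_⟩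
    · have := wordLen_strictMono.monotone hj
      have := wordLen_add_three j
      have := wordLen_add_three (j + 1)
      have := matchLen_le j
      have := iterate_six j
      simp only [add_assoc, Nat.reduceAdd] at *
      omega
    · rw [factor_eq_factor_iff]
      intro l hl
      rw [add_assoc, h1 _ (by omega)]
    · have := h2 (k + l) (by omega)
      simpa only [add_assoc] using this

theorem factor_ne_factor {j k k' : ℕ} (hlt : k < k') (hk' : k' + 2 * wordLen j ≤ matchLen j) :
    factor k (wordLen j) ≠ factor k' (wordLen j) := by
  intro h
  rw [factor_eq_factor_iff] at h
  obtain ⟨h1, h2⟩ := agree_iterate_six j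
  have hpos : 1 ≤ wordLen j := wordLen_strictMono.monotone (Nat.zero_le j)
  have hmatch : ∀ l < 3 * wordLen j, letter (blockStart^[j] 6 + k + l) =
      letter (blockStart^[j] 6 + k + l + (k' - k)) := by
    intro l
    induction l using Nat.strong_induction_on with
    | _ l ih =>
    intro hl
    rcases lt_or_ge l (wordLen j) with hlw | hge
    · rw [show blockStart^[j] 6 + k + l + (k' - k) = blockStart^[j] 6 + (k' + l) by omega,
        add_assoc, h1 _ (by omega), h1 _ (by omega), h l hlw]
    · have e := ih (l - wordLen j) (by omega) (by omega)
      have e1 := h2 (k + (l - wordLen j)) (by omega)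
      have e2 := h2 (k' + (l - wordLen j)) (by omega)
      rw [show blockStart^[j] 6 + (k + (l - wordLen j)) + wordLen j = blockStart^[j] 6 + k + l
        by omega, ← add_assoc] at e1
      rw [show blockStart^[j] 6 + (k' + (l - wordLen j)) + wordLen j =
        blockStart^[j] 6 + k + l + (k' - k) by omega,
        show blockStart^[j] 6 + (k' + (l - wordLen j)) =
          blockStart^[j] 6 + k + (l - wordLen j) + (k' - k) by omega] at e2
      rw [← e1, e, e2]
  have hm := matchLen_lt j
  obtain ⟨j', q, -, -, hd, h3, h4⟩ := repetition_structure (by omega) (by omega) hmatch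
  have hm' := matchLen_lt j'
  omega

theorem C_wordLen (n : ℕ) :
    C (wordLen n) = ∑ j ∈ Finset.range (n - 3), (matchLen j + 1 - 2 * wordLen j) := by
  let s : Finset (Σ _ : ℕ, ℕ) :=
    (Finset.range (n - 3)).sigma fun j => Finset.range (matchLen j + 1 - 2 * wordLen j)
  let g : (Σ _ : ℕ, ℕ) → List TLetter := fun y => factor y.2 (wordLen y.1)
  have hinj : Set.InjOn g s := by
    rintro ⟨j, k⟩ hy ⟨j', k'⟩ hy' heq
    simp only [s, Finset.coe_sigma, Set.mem_sigma_iff, Finset.coe_range, Set.mem_Iio] at hy hy'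
    have hlen := congrArg List.length heq
    simp only [g, length_factor] at hlen
    obtain rfl := wordLen_strictMono.injective hlen
    replace hy := hy.2
    replace hy' := hy'.2
    rcases lt_trichotomy k k' with h | rfl | h
    · exact (factor_ne_factor (j := j) h (by omega) heq).elim
    · rfl
    · exact (factor_ne_factor (j := j) h (by omega) heq.symm).elim
  have hset : {w : List TLetter | w ≠ [] ∧ w ++ w ++ w <:+: TPrefix (wordLen n)} = g '' s := by
    ext w
    rw [Set.mem_ofPred_eq, TPrefix_eq_factor, cube_isInfix_iff]
    simp only [s, g, Set.mem_image, Sigma.exists, Finset.coe_sigma, Set.mem_sigma_iff,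
      Finset.coe_range, Set.mem_Iio, and_assoc]
    refine exists_congr fun j => exists_congr fun k => ?_
    exact and_congr (by omega) (and_congr (by omega) Iff.rfl)
  calc C (wordLen n) = Set.ncard (g '' s) := by rw [← hset]; rfl
    _ = s.card := by rw [hinj.ncard_image, Set.ncard_coe_finset]
    _ = _ := by simp [s]

theorem two_mul_C_wordLen (n : ℕ) :
    2 * C (wordLen (n + 7)) + (n + 7) = wordLen (n + 2) + wordLen (n + 1) + 3 := by
  rw [C_wordLen, show n + 7 - 3 = n + 4 by omega]
  induction n with
  | zero => decide
  | succ n ih =>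
    rw [show n + 1 + 4 = n + 4 + 1 by omega, Finset.sum_range_succ]
    have h := two_mul_matchLen (n + 4)
    have h1 := wordLen_add_three (n + 3)
    have h2 := wordLen_add_three (n + 2)
    have h3 := wordLen_add_three (n + 1)
    have h4 := wordLen_strictMono (show n + 1 < n + 3 by omega)
    simp only [add_assoc, Nat.reduceAdd] at *
    omega

theorem t_natCast (n : ℕ) : t n = wordLen n := by
  rw [t, ← tribAux_add_two]
  rfl

end Tribonacci

open Tribonacci in
theorem distinct_cubes_at_tribonacci :
    (∀ m : ℤ, 0 ≤ m → m ≤ 6 → C (t m) = 0) ∧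
    (∀ m : ℤ, 7 ≤ m →
      (C (t m) : ℚ) = ((t (m - 5) : ℚ) + (t (m - 6) : ℚ) - (m : ℚ) + 3) / 2) := by
  refine ⟨fun m h0 h6 => ?_, fun m h7 => ?_⟩
  · lift m to ℕ using h0
    have h6 : m ≤ 6 := by omega
    rw [t_natCast, C_wordLen]
    interval_cases m <;> decide
  · obtain ⟨n, rfl⟩ : ∃ n : ℕ, m = ((n + 7 : ℕ) : ℤ) := ⟨(m - 7).toNat, by omega⟩
    have h := two_mul_C_wordLen n
    rw [show ((n + 7 : ℕ) : ℤ) - 5 = ((n + 2 : ℕ) : ℤ) by omega,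
      show ((n + 7 : ℕ) : ℤ) - 6 = ((n + 1 : ℕ) : ℤ) by omega, t_natCast, t_natCast, t_natCast]
    have h' : (2 * C (wordLen (n + 7)) + (n + 7) : ℚ) = wordLen (n + 2) + wordLen (n + 1) + 3 := by
      exact_mod_cast h
    push_cast
    linarith
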